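/- arXiv:2510.04579 — 3 statements merged into one kernel-verified Lean document; each statement's English description precedes it below -/
import Mathlib

section
/- Let μ0, μ1, ν be Borel probability measures on ℝ^d with finite second moments and let t ≥ 0. Then the infimum inf_{γ̃ ∈ Γ(μ0,μ1,ν)} ∫ ‖(1−t)x0 + t·x1 − y‖² dγ̃(x0,x1,y) is attained: there exists γ̃* ∈ Γ(μ0,μ1,ν) with ∫ ‖(1−t)x0 + t·x1 − y‖² dγ̃* equal to this infimum. -/
open MeasureTheory

noncomputable section

abbrev Euc (d : ℕ) := EuclideanSpace ℝ (Fin d)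

/-- The set of couplings of two measures on `ℝ^d`. -/
def couplings {d : ℕ} (α β : Measure (Euc d)) : Set (Measure (Euc d × Euc d)) :=
  {γ | γ.map Prod.fst = α ∧ γ.map Prod.snd = β}

/-- The quadratic optimal transport cost between two measures on `ℝ^d`. -/
def Tc {d : ℕ} (α β : Measure (Euc d)) : ℝ :=
  sInf ((fun γ => ∫ p, ‖p.1 - p.2‖ ^ 2 ∂γ) '' couplings α β)

/-- A coupling is optimal if it attains the quadratic transport cost. -/
def IsOptimalCoupling {d : ℕ} (γ : Measure (Euc d × Euc d)) (α β : Measure (Euc d)) : Prop :=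
  γ ∈ couplings α β ∧ (∫ p, ‖p.1 - p.2‖ ^ 2 ∂γ) = Tc α β

/-- The set `Π(μ0,μ1,ν)` of measures on `ℝ^d × ℝ^d × ℝ^d` with the three given
coordinate marginals. -/
def couplings3 {d : ℕ} (μ0 μ1 ν : Measure (Euc d)) :
    Set (Measure (Euc d × Euc d × Euc d)) :=
  {γ | γ.map (fun p => p.1) = μ0 ∧ γ.map (fun p => p.2.1) = μ1 ∧
    γ.map (fun p => p.2.2) = ν}

/-- The set `Γ(μ0,μ1,ν)` of three-way couplings whose `(x0,x1)`-marginal is an optimal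
coupling of `μ0` and `μ1`. -/
def GammaSet {d : ℕ} (μ0 μ1 ν : Measure (Euc d)) :
    Set (Measure (Euc d × Euc d × Euc d)) :=
  {γ ∈ couplings3 μ0 μ1 ν | IsOptimalCoupling (γ.map fun p => (p.1, p.2.1)) μ0 μ1}

open Filter Topology
open scoped NNReal ENNReal

theorem lowerSemicontinuous_lintegral_probabilityMeasure {X : Type*} [TopologicalSpace X]
    [MeasurableSpace X] [OpensMeasurableSpace X] {c : X → ℝ≥0} (hc : Continuous c) :
    LowerSemicontinuous fun μ : ProbabilityMeasure X => ∫⁻ x, c x ∂(μ : Measure X) := by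
  have h_sup (μ : ProbabilityMeasure X) : ∫⁻ x, c x ∂(μ : Measure X)
      = ⨆ n : ℕ, ∫⁻ x, ((min (c x) n : ℝ≥0) : ℝ≥0∞) ∂(μ : Measure X) := by
    rw [← lintegral_iSup]
    · congr with x
      apply le_antisymm
      · obtain ⟨n, hn⟩ := exists_nat_ge (c x)
        exact le_iSup_of_le n (by rw [min_eq_left hn])
      · exact iSup_le fun n => by exact_mod_cast min_le_left _ _
    · intro n
      exact (hc.min continuous_const).measurable.coe_nnreal_ennreal
    · intro m n hmn x
      simp only
      gcongr
  simp_rw [h_sup]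
  refine lowerSemicontinuous_iSup fun n => Continuous.lowerSemicontinuous ?_
  let f : BoundedContinuousFunction X ℝ≥0 :=
    .mkOfBound ⟨fun x => min (c x) n, hc.min continuous_const⟩ n fun x y => by
      simp only [ContinuousMap.coe_mk, NNReal.dist_eq]
      have hx : ((min (c x) n : ℝ≥0) : ℝ) ≤ n := by exact_mod_cast min_le_right (c x) n
      have hy : ((min (c y) n : ℝ≥0) : ℝ) ≤ n := by exact_mod_cast min_le_right (c y) n
      rw [abs_le]
      constructor <;> linarith [(min (c x) n).coe_nonneg, (min (c y) n).coe_nonneg]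
  exact ProbabilityMeasure.continuous_lintegral_boundedContinuousFunction f

theorem lowerSemicontinuousOn_integral_probabilityMeasure {X : Type*} [TopologicalSpace X]
    [MeasurableSpace X] [OpensMeasurableSpace X] {c : X → ℝ} (hc : Continuous c)
    (hc0 : ∀ x, 0 ≤ c x) {K : Set (ProbabilityMeasure X)}
    (hK : ∀ μ ∈ K, Integrable c (μ : Measure X)) :
    LowerSemicontinuousOn (fun μ : ProbabilityMeasure X => ∫ x, c x ∂(μ : Measure X)) K := by
  intro μ hμ a ha
  rcases lt_or_ge a 0 with ha0 | ha0
  · exact Eventually.of_forall fun ρ => ha0.trans_le (integral_nonneg hc0)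
  have key {ρ : ProbabilityMeasure X} (hρ : ρ ∈ K) : a < ∫ x, c x ∂(ρ : Measure X) ↔
      ENNReal.ofReal a < ∫⁻ x, (c x).toNNReal ∂(ρ : Measure X) := by
    change _ ↔ _ < ∫⁻ x, ENNReal.ofReal (c x) ∂(ρ : Measure X)
    rw [← ofReal_integral_eq_lintegral_ofReal (hK ρ hρ) (Eventually.of_forall hc0),
      ENNReal.ofReal_lt_ofReal_iff_of_nonneg ha0]
  have h := lowerSemicontinuous_lintegral_probabilityMeasure
    (continuous_real_toNNReal.comp hc) μ _ ((key hμ).1 ha)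
  filter_upwards [nhdsWithin_le_nhds h, self_mem_nhdsWithin] with ρ hρ hρK
  exact (key hρK).2 hρ

theorem isProbabilityMeasure_of_mem_couplings3 {d : ℕ} {μ0 μ1 ν : Measure (Euc d)}
    [IsProbabilityMeasure μ0] {γ : Measure (Euc d × Euc d × Euc d)}
    (hγ : γ ∈ couplings3 μ0 μ1 ν) : IsProbabilityMeasure γ := by
  have : IsProbabilityMeasure (γ.map fun p => p.1) := by rw [hγ.1]; infer_instance
  exact Measure.isProbabilityMeasure_of_map (μ := γ) fun p => p.1

theorem isCompact_couplings3 {d : ℕ} (μ0 μ1 ν : Measure (Euc d))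
    [IsProbabilityMeasure μ0] [IsProbabilityMeasure μ1] [IsProbabilityMeasure ν] :
    IsCompact {γ : ProbabilityMeasure (Euc d × Euc d × Euc d) |
      (γ : Measure (Euc d × Euc d × Euc d)) ∈ couplings3 μ0 μ1 ν} := by
  have h_closed : IsClosed {γ : ProbabilityMeasure (Euc d × Euc d × Euc d) |
      (γ : Measure (Euc d × Euc d × Euc d)) ∈ couplings3 μ0 μ1 ν} := by
    have marginal {f : Euc d × Euc d × Euc d → Euc d} (hf : Continuous f) (μ : Measure (Euc d))
        [IsProbabilityMeasure μ] : IsClosed {γ : ProbabilityMeasure (Euc d × Euc d × Euc d) |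
          (γ : Measure (Euc d × Euc d × Euc d)).map f = μ} := by
      let μ' : ProbabilityMeasure (Euc d) := ⟨μ, inferInstance⟩
      convert (isClosed_singleton (x := μ')).preimage
        (ProbabilityMeasure.continuous_map hf) using 1
      ext γ
      exact (Subtype.ext_iff (a1 := γ.map hf.measurable.aemeasurable) (a2 := μ')).symm
    exact (marginal continuous_fst μ0).inter ((marginal (by fun_prop) μ1).inter
      (marginal (by fun_prop) ν))
  rw [← h_closed.closure_eq]
  apply isCompact_closure_of_isTightMeasureSet
  have tight {S : Set (Measure (Euc d))} {μ : Measure (Euc d)} [IsProbabilityMeasure μ]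
      (hS : ∀ ρ ∈ S, ρ = μ) : IsTightMeasureSet S :=
    (isTightMeasureSet_singleton (μ := μ)).subset fun ρ hρ => hS ρ hρ
  refine IsTightMeasureSet.prodMk (tight (μ := μ0) ?_)
    (IsTightMeasureSet.prodMk (tight (μ := μ1) ?_) (tight (μ := ν) ?_))
  · rintro _ ⟨_, ⟨γ, hγ, rfl⟩, rfl⟩
    exact hγ.1
  · rintro _ ⟨_, ⟨_, ⟨γ, hγ, rfl⟩, rfl⟩, rfl⟩
    rw [Measure.fst, Measure.snd, Measure.map_map (by fun_prop) (by fun_prop)]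
    exact hγ.2.1
  · rintro _ ⟨_, ⟨_, ⟨γ, hγ, rfl⟩, rfl⟩, rfl⟩
    rw [Measure.snd, Measure.snd, Measure.map_map (by fun_prop) (by fun_prop)]
    exact hγ.2.2

/-- Every coupling of `μ0` and `μ1` is the `(x0,x1)`-marginal of a three-way coupling. -/
theorem exists_mem_couplings3_map_eq {d : ℕ} {μ0 μ1 ν : Measure (Euc d)}
    [IsProbabilityMeasure μ0] [IsProbabilityMeasure ν] {π : Measure (Euc d × Euc d)}
    (hπ : π ∈ couplings μ0 μ1) :
    ∃ γ ∈ couplings3 μ0 μ1 ν, γ.map (fun p => (p.1, p.2.1)) = π := by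
  have : IsProbabilityMeasure (π.map Prod.fst) := by rw [hπ.1]; infer_instance
  have : IsProbabilityMeasure π := Measure.isProbabilityMeasure_of_map (μ := π) Prod.fst
  have h_fst : (π.prod ν).map Prod.fst = π := by simp
  have h_snd : (π.prod ν).map Prod.snd = ν := by simp
  refine ⟨(π.prod ν).map MeasurableEquiv.prodAssoc, ⟨?_, ?_, ?_⟩, ?_⟩ <;>
    rw [Measure.map_map (by fun_prop) (by fun_prop)]
  · rw [← hπ.1, ← h_fst, Measure.map_map (by fun_prop) (by fun_prop), h_fst]
    rfl
  · rw [← hπ.2, ← h_fst, Measure.map_map (by fun_prop) (by fun_prop), h_fst]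
    rfl
  · exact h_snd
  · exact h_fst

theorem integrable_norm_smul_add_smul_sub_sq {d : ℕ} {μ0 μ1 ν : Measure (Euc d)}
    (hm0 : Integrable (fun x => ‖x‖ ^ 2) μ0) (hm1 : Integrable (fun x => ‖x‖ ^ 2) μ1)
    (hmν : Integrable (fun x => ‖x‖ ^ 2) ν) {γ : Measure (Euc d × Euc d × Euc d)}
    (hγ : γ ∈ couplings3 μ0 μ1 ν) (a b c : ℝ) :
    Integrable (fun p => ‖a • p.1 + b • p.2.1 + c • p.2.2‖ ^ 2) γ := by
  obtain ⟨rfl, rfl, rfl⟩ := hγ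
  rw [← memLp_two_iff_integrable_sq_norm (by fun_prop)] at *
  rw [memLp_map_measure_iff (by fun_prop) (by fun_prop)] at hm0 hm1 hmν
  exact ((hm0.const_smul a).add (hm1.const_smul b)).add (hmν.const_smul c)

/-- The infimum of `∫ ‖(1−t)x0 + t x1 − y‖²` over `Γ(μ0,μ1,ν)` is attained. -/
theorem stmt8 {d : ℕ} (μ0 μ1 ν : Measure (Euc d))
    [IsProbabilityMeasure μ0] [IsProbabilityMeasure μ1] [IsProbabilityMeasure ν]
    (hm0 : Integrable (fun x => ‖x‖ ^ 2) μ0) (hm1 : Integrable (fun x => ‖x‖ ^ 2) μ1)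
    (hmν : Integrable (fun x => ‖x‖ ^ 2) ν)
    (t : ℝ) (ht : 0 ≤ t) :
    ∃ γm ∈ GammaSet μ0 μ1 ν,
      (∫ p, ‖(1 - t) • p.1 + t • p.2.1 - p.2.2‖ ^ 2 ∂γm) =
        sInf ((fun γ => ∫ p, ‖(1 - t) • p.1 + t • p.2.1 - p.2.2‖ ^ 2 ∂γ) ''
          GammaSet μ0 μ1 ν) := by
  have hK := isCompact_couplings3 μ0 μ1 ν
  set K := {γ : ProbabilityMeasure (Euc d × Euc d × Euc d) |
    (γ : Measure (Euc d × Euc d × Euc d)) ∈ couplings3 μ0 μ1 ν}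
  have lift_mem {γ : Measure (Euc d × Euc d × Euc d)} (hγ : γ ∈ couplings3 μ0 μ1 ν) :
      ∃ γ' ∈ K, (γ' : Measure (Euc d × Euc d × Euc d)) = γ :=
    ⟨⟨γ, isProbabilityMeasure_of_mem_couplings3 hγ⟩, hγ, rfl⟩
  have transport_map (γ : Measure (Euc d × Euc d × Euc d)) :
      ∫ p, ‖p.1 - p.2‖ ^ 2 ∂(γ.map fun p => (p.1, p.2.1)) = ∫ p, ‖p.1 - p.2.1‖ ^ 2 ∂γ :=
    integral_map (by fun_prop) (by fun_prop)
  have transport_lsc : LowerSemicontinuousOn (fun γ : ProbabilityMeasure (Euc d × Euc d × Euc d) =>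
      ∫ p, ‖p.1 - p.2.1‖ ^ 2 ∂(γ : Measure (Euc d × Euc d × Euc d))) K := by
    refine lowerSemicontinuousOn_integral_probabilityMeasure (by fun_prop)
      (fun p => by positivity) fun γ hγ => ?_
    simpa [sub_eq_add_neg] using integrable_norm_smul_add_smul_sub_sq hm0 hm1 hmν hγ 1 (-1) 0
  have map_mem {γ : Measure (Euc d × Euc d × Euc d)} (hγ : γ ∈ couplings3 μ0 μ1 ν) :
      γ.map (fun p => (p.1, p.2.1)) ∈ couplings μ0 μ1 := by
    constructor <;> rw [Measure.map_map (by fun_prop) (by fun_prop)]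
    · exact hγ.1
    · exact hγ.2.1
  have Tc_le {π : Measure (Euc d × Euc d)} (hπ : π ∈ couplings μ0 μ1) :
      Tc μ0 μ1 ≤ ∫ p, ‖p.1 - p.2‖ ^ 2 ∂π :=
    csInf_le ⟨0, by rintro _ ⟨ρ, -, rfl⟩; exact integral_nonneg fun p => by positivity⟩
      ⟨π, hπ, rfl⟩
  have K_nonempty : K.Nonempty := by
    obtain ⟨γ, hγ, -⟩ := exists_mem_couplings3_map_eq (μ0 := μ0) (μ1 := μ1) (ν := ν)
      (π := μ0.prod μ1) ⟨by simp, by simp⟩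
    obtain ⟨γ', hγ', -⟩ := lift_mem hγ
    exact ⟨γ', hγ'⟩
  have mem_Gamma_iff (γ : ProbabilityMeasure (Euc d × Euc d × Euc d)) :
      (γ : Measure (Euc d × Euc d × Euc d)) ∈ GammaSet μ0 μ1 ν ↔ γ ∈ K ∩
        (fun γ : ProbabilityMeasure (Euc d × Euc d × Euc d) =>
          ∫ p, ‖p.1 - p.2.1‖ ^ 2 ∂(γ : Measure (Euc d × Euc d × Euc d))) ⁻¹'
            Set.Iic (Tc μ0 μ1) := by
    refine ⟨fun h => ⟨h.1, ?_⟩, fun h => ⟨h.1, map_mem h.1, ?_⟩⟩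
    · exact (transport_map _).symm.trans h.2.2 |>.le
    · exact le_antisymm ((transport_map _).trans_le h.2) (Tc_le (map_mem h.1))
  have Gamma_compact := transport_lsc.isCompact_inter_preimage_Iic hK (Tc μ0 μ1)
  have Gamma_nonempty : (K ∩ (fun γ : ProbabilityMeasure (Euc d × Euc d × Euc d) =>
      ∫ p, ‖p.1 - p.2.1‖ ^ 2 ∂(γ : Measure (Euc d × Euc d × Euc d))) ⁻¹'
        Set.Iic (Tc μ0 μ1)).Nonempty := by
    obtain ⟨γ, hγ, h_min⟩ := transport_lsc.exists_isMinOn K_nonempty hK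
    refine ⟨γ, hγ, ?_⟩
    rw [Set.mem_preimage, Set.mem_Iic, Tc]
    refine le_csInf (Set.Nonempty.image _ ⟨_, map_mem hγ⟩) ?_
    rintro _ ⟨π, hπ, rfl⟩
    obtain ⟨ρ, hρ, rfl⟩ := exists_mem_couplings3_map_eq (ν := ν) hπ
    obtain ⟨ρ', hρ', rfl⟩ := lift_mem hρ
    exact (h_min hρ').trans_eq (transport_map _).symm
  have cost_lsc : LowerSemicontinuousOn (fun γ : ProbabilityMeasure (Euc d × Euc d × Euc d) =>
      ∫ p, ‖(1 - t) • p.1 + t • p.2.1 - p.2.2‖ ^ 2 ∂(γ : Measure (Euc d × Euc d × Euc d))) K := by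
    refine lowerSemicontinuousOn_integral_probabilityMeasure (by fun_prop)
      (fun p => by positivity) fun γ hγ => ?_
    simpa [sub_eq_add_neg] using
      integrable_norm_smul_add_smul_sub_sq hm0 hm1 hmν hγ (1 - t) t (-1)
  obtain ⟨γ, hγ, h_min⟩ :=
    (cost_lsc.mono Set.inter_subset_left).exists_isMinOn Gamma_nonempty Gamma_compact
  have hγΓ := (mem_Gamma_iff γ).2 hγ
  refine ⟨γ, hγΓ, Eq.symm ?_⟩
  refine IsLeast.csInf_eq ⟨⟨_, hγΓ, rfl⟩, ?_⟩
  rintro _ ⟨ρ, hρ, rfl⟩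
  obtain ⟨ρ', -, rfl⟩ := lift_mem hρ.1
  exact h_min ((mem_Gamma_iff ρ').1 hρ)
end
end

section
/- Let G0, G1, Gν : (0,1) → ℝ be nondecreasing functions that are square-integrable on (0,1) with respect to Lebesgue measure (the quantile functions of probability measures μ0, μ1, ν on ℝ with finite second moments), and assume ∫₀¹ (G1(u) − G0(u))² du = 1. Then the function t ↦ (∫₀¹ (Gν(u) − (1−t)G0(u) − t·G1(u))² du)^{1/2} − t converges, as t → +∞, to −∫₀¹ (G1(u) − G0(u))·(Gν(u) − G0(u)) du. -/
open MeasureTheory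

open Filter Topology in
/-- A monic quadratic has `√(t² - 2bt + a) - t → -b` as `t → +∞`. -/
theorem tendsto_sqrt_quadratic_sub_self (a b : ℝ) :
    Tendsto (fun t : ℝ => √(t ^ 2 - 2 * b * t + a) - t) atTop (𝓝 (-b)) := by
  have hs : Tendsto (fun t : ℝ => t - b) atTop atTop :=
    tendsto_atTop_add_const_right atTop (-b) tendsto_id
  have hz : Tendsto (fun t : ℝ => |a - b ^ 2| / (t - b)) atTop (𝓝 0) := hs.const_div_atTop _
  rw [tendsto_iff_dist_tendsto_zero]
  refine squeeze_zero' (Eventually.of_forall fun _ => dist_nonneg) ?_ hz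
  filter_upwards [hs.eventually_gt_atTop 0,
    hs.eventually_ge_atTop (1 + |a - b ^ 2|)] with t ht htc
  have hq : 0 ≤ t ^ 2 - 2 * b * t + a := by
    nlinarith [neg_abs_le (a - b ^ 2), abs_nonneg (a - b ^ 2)]
  have hr := Real.sqrt_nonneg (t ^ 2 - 2 * b * t + a)
  have hsq := Real.sq_sqrt hq
  set r := √(t ^ 2 - 2 * b * t + a)
  rw [Real.dist_eq, le_div_iff₀ ht]
  calc |r - t - -b| * (t - b) ≤ |r - t - -b| * (r + (t - b)) := by gcongr; linarith
    _ = |(r - t - -b) * (r + (t - b))| := by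
      rw [abs_mul, abs_of_pos (add_pos_of_nonneg_of_pos hr ht)]
    _ = |a - b ^ 2| := by congr 1; linear_combination hsq

/-- A function monotone on a measurable set whose square is integrable there is in `L²`. -/
theorem MonotoneOn.memLp_two {f : ℝ → ℝ} {s : Set ℝ} (hs : MeasurableSet s)
    (hf : MonotoneOn f s) (hi : IntegrableOn (fun u => f u ^ 2) s) :
    MemLp f 2 (volume.restrict s) :=
  (memLp_two_iff_integrable_sq
    (aemeasurable_restrict_of_monotoneOn hs hf).aestronglyMeasurable).2 hi

/-- Expansion of the squared `L²` norm of `f - t • g`. -/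
theorem MeasureTheory.MemLp.integral_sub_mul_sq {α : Type*} [MeasurableSpace α] {μ : Measure α}
    {f g : α → ℝ} (hf : MemLp f 2 μ) (hg : MemLp g 2 μ) (t : ℝ) :
    ∫ u, (f u - t * g u) ^ 2 ∂μ =
      t ^ 2 * ∫ u, g u ^ 2 ∂μ - 2 * (∫ u, g u * f u ∂μ) * t + ∫ u, f u ^ 2 ∂μ := by
  have hfg : Integrable (fun u => g u * f u) μ := hg.integrable_mul hf
  calc ∫ u, (f u - t * g u) ^ 2 ∂μ
      = ∫ u, (t ^ 2 * g u ^ 2 - (2 * t) * (g u * f u) + f u ^ 2) ∂μ := by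
        congr 1; ext u; ring
    _ = _ := by
      rw [integral_add (by exact (hg.integrable_sq.const_mul _).sub (hfg.const_mul _))
          hf.integrable_sq,
        integral_sub (hg.integrable_sq.const_mul _) (hfg.const_mul _),
        integral_const_mul, integral_const_mul]
      ring

/-- Busemann function along a unit-speed geodesic ray in the 1D Wasserstein space, in
terms of quantile functions: if `G0, G1, Gν` are nondecreasing and square-integrable on
`(0,1)` with `∫ (G1 − G0)² = 1`, then
`‖Gν − (1−t)G0 − t G1‖_{L²} − t → −∫ (G1 − G0)(Gν − G0)` as `t → +∞`. -/
theorem stmt15 (G0 G1 Gν : ℝ → ℝ)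
    (h0 : MonotoneOn G0 (Set.Ioo 0 1)) (h1 : MonotoneOn G1 (Set.Ioo 0 1))
    (hν : MonotoneOn Gν (Set.Ioo 0 1))
    (hi0 : IntegrableOn (fun u => (G0 u) ^ 2) (Set.Ioo 0 1))
    (hi1 : IntegrableOn (fun u => (G1 u) ^ 2) (Set.Ioo 0 1))
    (hiν : IntegrableOn (fun u => (Gν u) ^ 2) (Set.Ioo 0 1))
    (hunit : (∫ u in Set.Ioo (0 : ℝ) 1, (G1 u - G0 u) ^ 2) = 1) :
    Filter.Tendsto
      (fun t : ℝ =>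
        Real.sqrt (∫ u in Set.Ioo (0 : ℝ) 1,
          (Gν u - (1 - t) * G0 u - t * G1 u) ^ 2) - t)
      Filter.atTop
      (nhds (-∫ u in Set.Ioo (0 : ℝ) 1, (G1 u - G0 u) * (Gν u - G0 u))) := by
  have m0 := h0.memLp_two measurableSet_Ioo hi0
  have m1 := h1.memLp_two measurableSet_Ioo hi1
  have mν := hν.memLp_two measurableSet_Ioo hiν
  have hexp (t : ℝ) : ∫ u in Set.Ioo (0 : ℝ) 1, (Gν u - (1 - t) * G0 u - t * G1 u) ^ 2 =
      t ^ 2 - 2 * (∫ u in Set.Ioo (0 : ℝ) 1, (G1 u - G0 u) * (Gν u - G0 u)) * t +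
        ∫ u in Set.Ioo (0 : ℝ) 1, (Gν u - G0 u) ^ 2 := by
    have h := (mν.sub m0).integral_sub_mul_sq (m1.sub m0) t
    simp only [Pi.sub_apply, hunit, mul_one] at h
    rw [← h]
    congr 1
    ext u
    ring
  simp only [hexp]
  exact tendsto_sqrt_quadratic_sub_self _ _
end

section
/- Let m0, m1, m ∈ ℝ and σ0, σ1, σ > 0 with σ1 ≥ σ0 and (m1 − m0)² + (σ1 − σ0)² = 1. Then the function t ↦ √((m − ((1−t)m0 + t·m1))² + (σ − ((1−t)σ0 + t·σ1))²) − t converges, as t → +∞, to −(m1 − m0)(m − m0) − (σ1 − σ0)(σ − σ0). -/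
theorem tendsto_sqrt_sq_add_sq_sub_self_atTop (k : ℝ) :
    Filter.Tendsto (fun u : ℝ => Real.sqrt (u ^ 2 + k ^ 2) - u) Filter.atTop (nhds 0) := by
  refine tendsto_of_tendsto_of_tendsto_of_le_of_le' tendsto_const_nhds
    (Filter.Tendsto.const_div_atTop Filter.tendsto_id (k ^ 2)) ?_ ?_
  · refine Filter.Eventually.of_forall fun u => sub_nonneg.2 (Real.le_sqrt_of_sq_le ?_)
    linarith [sq_nonneg k]
  · filter_upwards [Filter.eventually_gt_atTop 0] with u hu
    rw [id, sub_le_iff_le_add]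
    refine Real.sqrt_le_iff.2 ⟨by positivity, ?_⟩
    have h : (k ^ 2 / u + u) ^ 2 = (k ^ 2 / u) ^ 2 + 2 * k ^ 2 + u ^ 2 := by
      field_simp
      ring
    rw [h]
    linarith [sq_nonneg k, sq_nonneg (k ^ 2 / u)]


/-- Busemann function along a unit-speed geodesic ray of 1D Gaussians:
`W₂(N(m,σ²), μ_t) − t → −(m1−m0)(m−m0) − (σ1−σ0)(σ−σ0)` as `t → +∞`. -/
theorem stmt16 (m0 m1 m σ0 σ1 σ : ℝ) (h0 : 0 < σ0) (h1 : 0 < σ1) (hσ : 0 < σ)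
    (hord : σ0 ≤ σ1) (hunit : (m1 - m0) ^ 2 + (σ1 - σ0) ^ 2 = 1) :
    Filter.Tendsto
      (fun t : ℝ =>
        Real.sqrt ((m - ((1 - t) * m0 + t * m1)) ^ 2 +
            (σ - ((1 - t) * σ0 + t * σ1)) ^ 2) - t)
      Filter.atTop
      (nhds (-(m1 - m0) * (m - m0) - (σ1 - σ0) * (σ - σ0))) := by
  set b : ℝ := -(m1 - m0) * (m - m0) - (σ1 - σ0) * (σ - σ0) with hb
  have h := (tendsto_sqrt_sq_add_sq_sub_self_atTop
    ((m - m0) * (σ1 - σ0) - (σ - σ0) * (m1 - m0))).comp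
    (Filter.tendsto_atTop_add_const_right Filter.atTop b Filter.tendsto_id)
  have h' := h.add_const b
  rw [zero_add] at h'
  refine h'.congr fun t => ?_
  have hsq : (t + b) ^ 2 + ((m - m0) * (σ1 - σ0) - (σ - σ0) * (m1 - m0)) ^ 2 =
      (m - ((1 - t) * m0 + t * m1)) ^ 2 + (σ - ((1 - t) * σ0 + t * σ1)) ^ 2 := by
    rw [hb]
    linear_combination ((m - m0) ^ 2 + (σ - σ0) ^ 2 - t ^ 2) * hunit
  simp only [Function.comp_apply, id, hsq]
  ring
end
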